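/- arXiv:1804.08176 — 3 statements merged into one kernel-verified Lean document; each statement's English description precedes it below -/
import Mathlib

section
/- Let p be a prime, let n, d ≥ 1, and let f : {0,1}^n → {0,1} be computed by a polynomial of degree at most d over 𝔽_p. Then for every real α ∈ [0,1] and every integer k ≥ 1, there exists a torus polynomial P of degree at most (2k−1)·d such that |P(x) − α·f(x)| ≤ p^{-k} for all x ∈ {0,1}^n, where α·f(x) is interpreted in ℝ/ℤ. -/
open Finset

noncomputable section

/-- The one-dimensional torus `ℝ/ℤ`. -/
abbrev 𝕋 := AddCircle (1 : ℝ)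

/-- Real value of a Boolean input bit. -/
def bval {n : ℕ} (x : Fin n → Bool) (i : Fin n) : ℝ := if x i then 1 else 0

/-- Hamming weight of a Boolean input. -/
def wt {n : ℕ} (x : Fin n → Bool) : ℕ := ∑ i, if x i then 1 else 0

/-- `P` is a torus polynomial of degree at most `d` in `n` variables. -/
def IsTorusPoly {n : ℕ} (d : ℕ) (P : (Fin n → Bool) → 𝕋) : Prop :=
  ∃ c : Finset (Fin n) → ℝ, (∀ S, d < S.card → c S = 0) ∧
    ∀ x, P x = ((∑ S : Finset (Fin n), c S * ∏ i ∈ S, bval x i : ℝ) : 𝕋)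

/-- `P` ε-approximates the Boolean function `f`. -/
def Approx {n : ℕ} (P : (Fin n → Bool) → 𝕋) (f : (Fin n → Bool) → Bool) (ε : ℝ) : Prop :=
  ∀ x, ‖P x - (((if f x then 1 else 0) / 2 : ℝ) : 𝕋)‖ ≤ ε

/-- The modulus-amplifying polynomial of degree `2k - 1`: modulo `y ^ k` it is `0`, and
modulo `(1 - y) ^ k` it is `1`. -/
def amplify {R : Type*} [CommRing R] (k : ℕ) (y : R) : R :=
  ∑ i ∈ Finset.Ico k (2 * k), y ^ i * (1 - y) ^ (2 * k - 1 - i) * ((2 * k - 1).choose i : R)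

theorem pow_dvd_amplify {R : Type*} [CommRing R] (k : ℕ) (y : R) : y ^ k ∣ amplify k y :=
  Finset.dvd_sum fun _ hi =>
    ((pow_dvd_pow y (Finset.mem_Ico.1 hi).1).mul_right _).mul_right _

theorem pow_dvd_one_sub_amplify {R : Type*} [CommRing R] {k : ℕ} (hk : 1 ≤ k) (y : R) :
    (1 - y) ^ k ∣ 1 - amplify k y := by
  have key : 1 - amplify k y = ∑ i ∈ Finset.range k,
      y ^ i * (1 - y) ^ (2 * k - 1 - i) * ((2 * k - 1).choose i : R) := by
    have h := add_pow y (1 - y) (2 * k - 1)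
    rw [add_sub_cancel, one_pow, Nat.sub_add_cancel (by omega),
      ← Finset.sum_range_add_sum_Ico _ (by omega : k ≤ 2 * k)] at h
    exact sub_eq_of_eq_add h
  rw [key]
  refine Finset.dvd_sum fun i hi => ?_
  have := Finset.mem_range.1 hi
  exact ((pow_dvd_pow (1 - y) (by omega)).mul_left _).mul_right _

theorem totalDegree_amplify_le {σ R : Type*} [CommRing R] {d : ℕ} (k : ℕ)
    {G : MvPolynomial σ R} (hG : G.totalDegree ≤ d) :
    (amplify k G).totalDegree ≤ (2 * k - 1) * d := by
  refine MvPolynomial.totalDegree_finsetSum_le fun i hi => ?_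
  have hi := Finset.mem_Ico.1 hi
  have h1 : (1 - G).totalDegree ≤ d :=
    (MvPolynomial.totalDegree_sub _ _).trans (by simpa using hG)
  have hc : ((((2 * k - 1).choose i : ℕ) : MvPolynomial σ R)).totalDegree = 0 := by
    rw [← map_natCast (MvPolynomial.C (σ := σ) (R := R)), MvPolynomial.totalDegree_C]
  calc _ ≤ (G ^ i * (1 - G) ^ (2 * k - 1 - i)).totalDegree + 0 :=
        hc ▸ MvPolynomial.totalDegree_mul _ _
    _ ≤ i * G.totalDegree + (2 * k - 1 - i) * (1 - G).totalDegree :=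
        (MvPolynomial.totalDegree_mul _ _).trans
          (add_le_add (MvPolynomial.totalDegree_pow _ _) (MvPolynomial.totalDegree_pow _ _))
    _ ≤ i * d + (2 * k - 1 - i) * d := by gcongr
    _ = (2 * k - 1) * d := by rw [← add_mul]; congr 1; omega

/-- A polynomial over `ZMod p` lifts to one over `ℤ` without raising the total degree. -/
theorem exists_int_lift {σ : Type*} {p : ℕ} (F : MvPolynomial σ (ZMod p)) :
    ∃ G : MvPolynomial σ ℤ, G.totalDegree ≤ F.totalDegree ∧
      MvPolynomial.map (Int.castRingHom (ZMod p)) G = F := by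
  refine ⟨∑ m ∈ F.support, MvPolynomial.monomial m ((F.coeff m).cast : ℤ), ?_, ?_⟩
  · refine MvPolynomial.totalDegree_finsetSum_le fun m hm => ?_
    exact (MvPolynomial.totalDegree_monomial_le _ _).trans (MvPolynomial.le_totalDegree hm)
  · conv_rhs => rw [F.as_sum]
    simp [MvPolynomial.map_monomial]

/-- On the Boolean cube, a real polynomial of total degree at most `D` agrees with a multilinear
one of degree at most `D`. -/
theorem isTorusPoly_of_totalDegree_le {n D : ℕ} {Q : MvPolynomial (Fin n) ℝ}
    (hQ : Q.totalDegree ≤ D) :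
    IsTorusPoly D fun x => ((MvPolynomial.eval (bval x) Q : ℝ) : 𝕋) := by
  refine ⟨fun S => ∑ m ∈ Q.support with m.support = S, Q.coeff m, fun S hS => ?_, fun x => ?_⟩
  · refine Finset.sum_eq_zero fun m hm => ?_
    obtain ⟨hmQ, rfl⟩ := Finset.mem_filter.1 hm
    have h1 : m.support.card ≤ m.sum fun _ e => e := by
      rw [Finset.card_eq_sum_ones]
      exact Finset.sum_le_sum fun i hi => Nat.one_le_iff_ne_zero.2 (Finsupp.mem_support_iff.1 hi)
    have h2 := MvPolynomial.le_totalDegree hmQ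
    omega
  · dsimp only
    congr 1
    rw [MvPolynomial.eval_eq, ← Finset.sum_fiberwise Q.support (fun m => m.support)]
    refine Finset.sum_congr rfl fun S _ => ?_
    rw [Finset.sum_mul]
    refine Finset.sum_congr rfl fun m hm => ?_
    obtain ⟨-, rfl⟩ := Finset.mem_filter.1 hm
    congr 1
    refine Finset.prod_congr rfl fun i hi => ?_
    have := Finsupp.mem_support_iff.1 hi
    unfold bval
    split_ifs <;> simp [this]

theorem eval_map_ite {n : ℕ} {S : Type*} [CommRing S] (x : Fin n → Bool)
    (G : MvPolynomial (Fin n) ℤ) :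
    MvPolynomial.eval (fun i => if x i then (1 : S) else 0)
        (MvPolynomial.map (Int.castRingHom S) G)
      = ((MvPolynomial.eval (fun i => if x i then (1 : ℤ) else 0) G : ℤ) : S) := by
  rw [← eq_intCast (Int.castRingHom S), MvPolynomial.eval_map, ← MvPolynomial.eval₂_id,
    MvPolynomial.hom_eval₂, RingHom.comp_id]
  congr 1
  funext i
  split_ifs <;> simp

theorem norm_coe_le_abs_sub_int (r : ℝ) (z : ℤ) : ‖((r : ℝ) : 𝕋)‖ ≤ |r - z| := by
  rw [UnitAddCircle.norm_eq]
  exact round_le r z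

/-- if a Boolean function is computed by a degree-`d` polynomial over `𝔽_p`,
then for every `α ∈ [0,1]` and integer `k ≥ 1` there is a torus polynomial `P` of degree
at most `(2k-1)·d` with `|P(x) − α·f(x)| ≤ p^{-k}` for all `x`. -/
theorem stmt_1 (p n d : ℕ) (hp : p.Prime) (hn : 1 ≤ n) (hd : 1 ≤ d)
    (f : (Fin n → Bool) → Bool) (F : MvPolynomial (Fin n) (ZMod p))
    (hdeg : F.totalDegree ≤ d)
    (hcomp : ∀ x : Fin n → Bool,
      MvPolynomial.eval (fun i => if x i then (1 : ZMod p) else 0) F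
        = (if f x then 1 else 0))
    (α : ℝ) (hα : α ∈ Set.Icc (0 : ℝ) 1) (k : ℕ) (hk : 1 ≤ k) :
    ∃ P : (Fin n → Bool) → 𝕋, IsTorusPoly ((2 * k - 1) * d) P ∧
      ∀ x, ‖P x - ((α * (if f x then 1 else 0) : ℝ) : 𝕋)‖ ≤ ((p : ℝ) ^ k)⁻¹ := by
  have := Fact.mk hp
  obtain ⟨G, hG, rfl⟩ := exists_int_lift F
  have hpk : (0 : ℝ) < (p : ℝ) ^ k := pow_pos (by exact_mod_cast hp.pos) k
  set a : ℤ := ⌊α * (p : ℝ) ^ k⌋ with ha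
  set H : MvPolynomial (Fin n) ℝ :=
    MvPolynomial.C ((a : ℝ) / (p : ℝ) ^ k) *
      MvPolynomial.map (Int.castRingHom ℝ) (amplify k G) with hH
  have hHdeg : H.totalDegree ≤ (2 * k - 1) * d := by
    refine (MvPolynomial.totalDegree_mul _ _).trans ?_
    rw [MvPolynomial.totalDegree_C, zero_add]
    exact (Finset.sup_mono (MvPolynomial.support_map_subset _ _)).trans
      (totalDegree_amplify_le k (hG.trans hdeg))
  refine ⟨_, isTorusPoly_of_totalDegree_le hHdeg, fun x => ?_⟩
  set y : ℤ := MvPolynomial.eval (fun i => if x i then (1 : ℤ) else 0) G with hy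
  have hyF : (y : ZMod p) = if f x then 1 else 0 := by
    rw [← hcomp x, hy, eval_map_ite]
  have hev : MvPolynomial.eval (bval x) H
      = (a : ℝ) / (p : ℝ) ^ k * ((amplify k y : ℤ) : ℝ) := by
    have hA : MvPolynomial.eval (fun i => if x i then (1 : ℤ) else 0) (amplify k G)
        = amplify k y := by
      simp [amplify, hy]
    rw [hH, map_mul, MvPolynomial.eval_C, ← hA, ← eval_map_ite (S := ℝ) x]
    rfl
  have hmod : ∃ m : ℤ, amplify k y = (if f x then 1 else 0) + (p : ℤ) ^ k * m := by
    by_cases hf : f x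
    · have h1 : (p : ℤ) ∣ 1 - y := by
        rw [← ZMod.intCast_zmod_eq_zero_iff_dvd]
        simp [hyF, hf]
      obtain ⟨m, hm⟩ := (pow_dvd_pow_of_dvd h1 k).trans (pow_dvd_one_sub_amplify hk y)
      exact ⟨-m, by simp only [hf, if_true]; linarith⟩
    · have h1 : (p : ℤ) ∣ y := by
        rw [← ZMod.intCast_zmod_eq_zero_iff_dvd]
        simp [hyF, hf]
      obtain ⟨m, hm⟩ := (pow_dvd_pow_of_dvd h1 k).trans (pow_dvd_amplify k y)
      exact ⟨m, by simp [hf, hm]⟩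
  obtain ⟨m, hm⟩ := hmod
  have herr : |(a : ℝ) / (p : ℝ) ^ k - α| ≤ ((p : ℝ) ^ k)⁻¹ := by
    have h1 := Int.floor_le (α * (p : ℝ) ^ k)
    have h2 := Int.lt_floor_add_one (α * (p : ℝ) ^ k)
    rw [← ha] at h1 h2
    have h3 : (a : ℝ) / (p : ℝ) ^ k - α = (a - α * (p : ℝ) ^ k) / (p : ℝ) ^ k := by
      field_simp
    rw [h3, abs_div, abs_of_pos hpk, inv_eq_one_div]
    gcongr
    rw [abs_le]
    constructor <;> linarith
  rw [hev, ← AddCircle.coe_sub]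
  refine (norm_coe_le_abs_sub_int _ (a * m)).trans ?_
  have hsub : (a : ℝ) / (p : ℝ) ^ k * ((amplify k y : ℤ) : ℝ)
      - α * (if f x then 1 else 0) - ((a * m : ℤ) : ℝ)
      = ((a : ℝ) / (p : ℝ) ^ k - α) * (if f x then 1 else 0) := by
    rw [hm]
    push_cast
    field_simp
    ring
  rw [hsub]
  split_ifs
  · simpa using herr
  · simp
end
end

section
/- Let n ≥ 1, d ≥ 0, and k ≥ 0 be integers. Suppose that for every symmetric Boolean function f : {0,1}^n → {0,1} (i.e., f(x) depends only on the Hamming weight of x) there exist integers q_0, …, q_d with |q_j| ≤ 2^k − 1 for all j such that the symmetric torus polynomial Q(x) = ∑_{j=0}^{d} (q_j/2^k)(x_1 + ⋯ + x_n)^j (mod 1) (1/10)-approximates f. Then (k+1)(d+1) ≥ n. -/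
open Finset

noncomputable section

/-- \`P\` is a symmetric torus polynomial of degree at most \`d\` in \`n\` variables:
\`P(x) = ∑_{j=0}^d c_j (x_1 + ⋯ + x_n)^j (mod 1)\`. -/
def IsSymTorusPoly {n : ℕ} (d : ℕ) (P : (Fin n → Bool) → 𝕋) : Prop :=
  ∃ c : ℕ → ℝ, ∀ x, P x = ((∑ j ∈ Finset.range (d + 1), c j * (wt x : ℝ) ^ j : ℝ) : 𝕋)

/-- The delta function \`Δ_w\`: value 1 exactly on inputs of Hamming weight \`w\`. -/
def delta {n : ℕ} (w : ℕ) (x : Fin n → Bool) : Bool := decide (wt x = w)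

/-- MAJORITY on \`m\` bits: value 1 exactly on inputs of Hamming weight at least \`m/2\`. -/
def maj {m : ℕ} (x : Fin m → Bool) : Bool := decide (m ≤ 2 * wt x)

theorem exists_wt_eq {n w : ℕ} (hw : w ≤ n) : ∃ x : Fin n → Bool, wt x = w := by
  refine ⟨fun i => decide ((i : ℕ) < w), ?_⟩
  simp [wt, Fin.card_filter_val_lt, hw]

theorem norm_coe_half : ‖((1 / 2 : ℝ) : 𝕋)‖ = 1 / 2 := by
  simpa using AddCircle.norm_half_period_eq (p := (1 : ℝ))

/-- A function on the cube `1/10`-approximates at most one Boolean function. -/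
theorem Approx.unique {n : ℕ} {P : (Fin n → Bool) → 𝕋} {f g : (Fin n → Bool) → Bool}
    (hf : Approx P f (1 / 10)) (hg : Approx P g (1 / 10)) : f = g := by
  funext x
  have hd : ‖(((if f x then 1 else 0) / 2 : ℝ) : 𝕋) - (((if g x then 1 else 0) / 2 : ℝ) : 𝕋)‖
      ≤ 1 / 10 + 1 / 10 := by
    rw [← sub_sub_sub_cancel_left _ _ (P x)]
    exact (norm_sub_le _ _).trans (add_le_add (hg x) (hf x))
  have hh := norm_coe_half
  cases hfx : f x <;> cases hgx : g x <;>
    simp only [hfx, hgx, if_true, Bool.false_eq_true, if_false, zero_div, AddCircle.coe_zero,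
      sub_zero, zero_sub, norm_neg, hh] at hd ⊢ <;> norm_num at hd

/-- if every symmetric Boolean function on `n` variables is
`1/10`-approximated by a symmetric torus polynomial of degree at most `d` whose
coefficients are of the form `q_j/2^k` with `|q_j| ≤ 2^k − 1`, then `(k+1)(d+1) ≥ n`. -/
theorem stmt_6 (n d k : ℕ) (hn : 1 ≤ n)
    (h : ∀ f : (Fin n → Bool) → Bool, (∀ x y, wt x = wt y → f x = f y) →
      ∃ q : ℕ → ℤ, (∀ j, |q j| ≤ 2 ^ k - 1) ∧
        Approx (fun x => ((∑ j ∈ Finset.range (d + 1),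
          ((q j : ℝ) / 2 ^ k) * (wt x : ℝ) ^ j : ℝ) : 𝕋)) f (1 / 10)) :
    n ≤ (k + 1) * (d + 1) := by
  choose q hq happ using fun g : Fin (n + 1) → Bool =>
    h (fun x => g (Fin.ofNat (n + 1) (wt x))) (fun x y hxy => by simp only [hxy])
  let F : (Fin (n + 1) → Bool) → Fin (d + 1) → Finset.Icc (-(2 ^ k - 1) : ℤ) (2 ^ k - 1) :=
    fun g j => ⟨q g j, Finset.mem_Icc.2 (abs_le.1 (hq g j))⟩
  have hF : Function.Injective F := by
    intro g g' hgg
    have hcoeff : ∀ j ∈ Finset.range (d + 1), q g j = q g' j := fun j hj =>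
      congrArg Subtype.val (congrFun hgg ⟨j, Finset.mem_range.1 hj⟩)
    have hg := happ g
    have hpoly : ∀ x : Fin n → Bool,
        (∑ j ∈ Finset.range (d + 1), ((q g j : ℝ) / 2 ^ k) * (wt x : ℝ) ^ j) =
          ∑ j ∈ Finset.range (d + 1), ((q g' j : ℝ) / 2 ^ k) * (wt x : ℝ) ^ j := fun x =>
      Finset.sum_congr rfl fun j hj => by rw [hcoeff j hj]
    simp only [hpoly] at hg
    have heq := hg.unique (happ g')
    funext w
    obtain ⟨x, hx⟩ := exists_wt_eq (Nat.lt_succ_iff.1 w.isLt)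
    simpa [hx] using congrFun heq x
  have hcard := Fintype.card_le_of_injective F hF
  have hIcc : (Finset.Icc (-(2 ^ k - 1) : ℤ) (2 ^ k - 1)).card ≤ 2 ^ (k + 1) := by
    rw [Int.card_Icc, Int.toNat_le]
    push_cast
    rw [pow_succ]
    linarith
  simp only [Fintype.card_fun, Fintype.card_bool, Fintype.card_fin, Fintype.card_coe] at hcard
  have hle : 2 ^ (n + 1) ≤ 2 ^ ((k + 1) * (d + 1)) :=
    hcard.trans ((Nat.pow_le_pow_left hIcc _).trans_eq (pow_mul _ _ _).symm)
  exact (Nat.le_succ n).trans ((Nat.pow_le_pow_iff_right (by norm_num)).1 hle)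
end
end

section
/- Let n ≥ 1, d ≥ 0, k ≥ 0 be integers and δ > 0 with (d+1)·n^d ≤ δ·2^k. Let Q(x) = ∑_{j=0}^{d} c_j (x_1 + ⋯ + x_n)^j (mod 1) be a symmetric torus polynomial with coefficients c_j ∈ [0,1). Then there exist integers q_0, …, q_d with 0 ≤ q_j ≤ 2^k − 1 such that the symmetric torus polynomial Q'(x) = ∑_{j=0}^{d} (q_j/2^k)(x_1 + ⋯ + x_n)^j (mod 1) satisfies |Q(x) − Q'(x)| ≤ δ for all x ∈ {0,1}^n. -/
open Finset

noncomputable section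

/-- The norm on the circle is dominated by the absolute value of a representative. -/
theorem norm_coe_torus_le_abs (r : ℝ) : ‖(r : 𝕋)‖ ≤ |r| :=
  QuotientAddGroup.norm_mk_le_norm

theorem wt_le {n : ℕ} (x : Fin n → Bool) : wt x ≤ n := by
  unfold wt
  calc ∑ i, (if x i then 1 else 0) ≤ ∑ _i : Fin n, 1 :=
        Finset.sum_le_sum fun i _ => by split_ifs <;> simp
    _ = n := by simp

/-- Rounding a real number down to a multiple of `1 / m` moves it by at most `1 / m`. -/
theorem abs_sub_floor_mul_div_le (a : ℝ) {m : ℝ} (hm : 0 < m) :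
    |a - (⌊a * m⌋ : ℝ) / m| ≤ 1 / m := by
  have h : a - (⌊a * m⌋ : ℝ) / m = Int.fract (a * m) / m := by
    rw [Int.fract]
    field_simp
  rw [h, abs_of_nonneg (div_nonneg (Int.fract_nonneg _) hm.le)]
  gcongr
  exact (Int.fract_lt_one _).le

/-- rounding the coefficients of a symmetric torus polynomial to dyadic
rationals `q_j/2^k` changes its values on the Boolean cube by at most `δ`, provided
`(d+1)·n^d ≤ δ·2^k`. -/
theorem stmt_14 (n d k : ℕ) (hn : 1 ≤ n) (δ : ℝ) (hδ : 0 < δ)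
    (hcond : ((d : ℝ) + 1) * (n : ℝ) ^ d ≤ δ * 2 ^ k)
    (c : ℕ → ℝ) (hc : ∀ j, 0 ≤ c j ∧ c j < 1) :
    ∃ q : ℕ → ℤ, (∀ j, 0 ≤ q j ∧ q j ≤ 2 ^ k - 1) ∧
      ∀ x : Fin n → Bool,
        ‖((∑ j ∈ Finset.range (d + 1), c j * (wt x : ℝ) ^ j : ℝ) : 𝕋)
          - ((∑ j ∈ Finset.range (d + 1), ((q j : ℝ) / 2 ^ k) * (wt x : ℝ) ^ j : ℝ) : 𝕋)‖
          ≤ δ := by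
  have hm : (0 : ℝ) < 2 ^ k := by positivity
  refine ⟨fun j => ⌊c j * 2 ^ k⌋, fun j => ⟨Int.floor_nonneg.mpr ?_, ?_⟩, fun x => ?_⟩
  · exact mul_nonneg (hc j).1 hm.le
  · rw [Int.le_sub_one_iff, Int.floor_lt]
    push_cast
    nlinarith [(hc j).2]
  · rw [← AddCircle.coe_sub, ← Finset.sum_sub_distrib]
    refine (norm_coe_torus_le_abs _).trans ?_
    have hn1 : (1 : ℝ) ≤ n := by exact_mod_cast hn
    have hw : (wt x : ℝ) ≤ n := by exact_mod_cast wt_le x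
    calc _ ≤ ∑ j ∈ Finset.range (d + 1),
          |c j * (wt x : ℝ) ^ j - (⌊c j * 2 ^ k⌋ : ℝ) / 2 ^ k * (wt x : ℝ) ^ j| :=
          Finset.abs_sum_le_sum_abs _ _
      _ ≤ ∑ _j ∈ Finset.range (d + 1), 1 / 2 ^ k * (n : ℝ) ^ d := by
          refine Finset.sum_le_sum fun j hj => ?_
          rw [← sub_mul, abs_mul, abs_of_nonneg (a := (wt x : ℝ) ^ j) (by positivity)]
          have hjd : j ≤ d := Nat.lt_succ_iff.mp (Finset.mem_range.mp hj)
          have hpow : (wt x : ℝ) ^ j ≤ (n : ℝ) ^ d :=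
            (pow_le_pow_left₀ (by positivity) hw j).trans (pow_le_pow_right₀ hn1 hjd)
          exact mul_le_mul (abs_sub_floor_mul_div_le _ hm) hpow (by positivity) (by positivity)
      _ = ((d : ℝ) + 1) * (n : ℝ) ^ d / 2 ^ k := by
          rw [Finset.sum_const, Finset.card_range, nsmul_eq_mul]
          push_cast
          ring
      _ ≤ δ := (div_le_iff₀ hm).mpr hcond
end
end
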